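/- A normal completely positive map φ : B(K) → B(K) is k-superpositive (i.e., lies in the closure of the cone E_k generated by {Ad_V : V ∈ B(K), rank V ≤ k} with respect to the norm ‖φ‖_D = ‖D_φ‖_{T(H)}) if and only if D_φ ∈ S_k. -/

import Mathlib

set_option synthInstance.maxHeartbeats 1000000
set_option maxHeartbeats 1000000

noncomputable section

open scoped InnerProductSpace ComplexOrder
open ContinuousLinearMap

local notation "⟪" x ", " y "⟫" => @inner ℂ _ _ x y

namespace ChoiInf

variable {H : Type*} [NormedAddCommGroup H] [InnerProductSpace ℂ H] [CompleteSpace H]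

/-- The rank one operator `x ⊠ y : z ↦ (z|y)·x = ⟪y, z⟫ • x`
(inner products written with Mathlib's convention: conjugate linear in the
first variable, so that the paper's `(z|y)` is `⟪y, z⟫`). -/
def rankOne (x y : H) : H →L[ℂ] H := (innerSL ℂ y).smulRight x

/-- The trace of an operator, computed relative to a Hilbert basis:
`Tr X = Σᵢ (X eᵢ | eᵢ) = Σᵢ ⟪eᵢ, X eᵢ⟫`.  (For trace class operators this does
not depend on the choice of basis.) -/
def tr {ι : Type*} (b : HilbertBasis ι ℂ H) (T : H →L[ℂ] H) : ℂ :=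
  ∑' i, ⟪b i, T (b i)⟫

/-- The bilinear pairing `⟨A, B⟩ = Tr (A B)` between `B(H)` and `T(H)`. -/
def pairing {ι : Type*} (b : HilbertBasis ι ℂ H) (A T : H →L[ℂ] H) : ℂ :=
  tr b (A ∘L T)

/-- Trace class operators, characterized by nuclear representations
`T = Σₙ xₙ ⊠ yₙ` with `Σₙ ‖xₙ‖‖yₙ‖ < ∞`. -/
def IsTraceClass (T : H →L[ℂ] H) : Prop :=
  ∃ x y : ℕ → H, Summable (fun n => ‖x n‖ * ‖y n‖) ∧
    ∀ z, T z = ∑' n, ⟪y n, z⟫ • x n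

/-- The trace norm, as the infimum of `Σₙ ‖xₙ‖‖yₙ‖` over all nuclear
representations `T = Σₙ xₙ ⊠ yₙ`. -/
def traceNorm (T : H →L[ℂ] H) : ℝ :=
  sInf {c : ℝ | ∃ x y : ℕ → H, HasSum (fun n => ‖x n‖ * ‖y n‖) c ∧
    ∀ z, T z = ∑' n, ⟪y n, z⟫ • x n}

/-- `(Φ, Φst)` is a dual pair:  `Φst` preserves the trace class and
`⟨Φ A, T⟩ = ⟨A, Φst T⟩` for all trace class `T`.  A linear map `Φ` on `B(H)` is
normal (σ-weakly continuous) precisely when it admits such a predual map `Φst`. -/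
def IsNormalPair {ι : Type*} (b : HilbertBasis ι ℂ H)
    (Φ Φst : (H →L[ℂ] H) →ₗ[ℂ] (H →L[ℂ] H)) : Prop :=
  (∀ T, IsTraceClass T → IsTraceClass (Φst T)) ∧
    ∀ A T, IsTraceClass T → pairing b (Φ A) T = pairing b A (Φst T)

/-- Positivity of a `k × k` matrix of operators, i.e. positivity of the
corresponding operator on `H ⊕ ⋯ ⊕ H`. -/
def MatPos {k : ℕ} (A : Fin k → Fin k → (H →L[ℂ] H)) : Prop :=
  ∀ v : Fin k → H, 0 ≤ ∑ i, ∑ j, ⟪v i, A i j (v j)⟫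

/-- The operator on `H ⊕ ⋯ ⊕ H` given by a `k × k` matrix of operators has norm `≤ c`. -/
def matNormLe {k : ℕ} (A : Fin k → Fin k → (H →L[ℂ] H)) (c : ℝ) : Prop :=
  ∀ v w : Fin k → H,
    ‖∑ i, ∑ j, ⟪w i, A i j (v j)⟫‖ ≤
      c * Real.sqrt (∑ i, ‖v i‖ ^ 2) * Real.sqrt (∑ i, ‖w i‖ ^ 2)

/-- A von Neumann algebra is a factor when its center consists of the scalars. -/
def IsFactor (M : VonNeumannAlgebra H) : Prop :=
  ∀ T ∈ M, T ∈ M.commutant → ∃ c : ℂ, T = c • (1 : H →L[ℂ] H)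

/-- `x0` is a cyclic vector for `M`. -/
def Cyclic (M : VonNeumannAlgebra H) (x0 : H) : Prop :=
  Dense {y : H | ∃ A ∈ M, A x0 = y}

/-- `x0` is a separating vector for `M`. -/
def Separating (M : VonNeumannAlgebra H) (x0 : H) : Prop :=
  ∀ A ∈ M, A x0 = 0 → A = 0

/-- `Φ` restricts on `alg(M', M)` to the map `φ̃ : A'B ↦ A'·φ(B)`.
(Maps `φ : M → M` are encoded as linear maps on `B(H)` sending `M` into `M`;
only the restriction to `M` is relevant.) -/
def ExtendsTilde (M : VonNeumannAlgebra H)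
    (φ Φ : (H →L[ℂ] H) →ₗ[ℂ] (H →L[ℂ] H)) : Prop :=
  ∀ A' ∈ M.commutant, ∀ B ∈ M, Φ (A' * B) = A' * φ B

/-- The space `CB^σ_ε(M)` of maps `φ : M → M` such that `φ̃` extends to a normal
map on `B(H)`. -/
def CBSigmaE {ι : Type*} (b : HilbertBasis ι ℂ H) (M : VonNeumannAlgebra H) :
    Set ((H →L[ℂ] H) →ₗ[ℂ] (H →L[ℂ] H)) :=
  {φ | (∀ B ∈ M, φ B ∈ M) ∧
    ∃ Φ Φst, ExtendsTilde M φ Φ ∧ IsNormalPair b Φ Φst}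

/-- `φ` is completely positive as a map on `M`. -/
def IsCPOn (M : VonNeumannAlgebra H) (φ : (H →L[ℂ] H) →ₗ[ℂ] (H →L[ℂ] H)) : Prop :=
  ∀ (k : ℕ) (A : Fin k → Fin k → (H →L[ℂ] H)), (∀ i j, A i j ∈ M) →
    MatPos A → MatPos fun i j => φ (A i j)

/-- `φ` is completely positive (on all of `B(H)`). -/
def IsCPFull (φ : (H →L[ℂ] H) →ₗ[ℂ] (H →L[ℂ] H)) : Prop :=
  ∀ (k : ℕ) (A : Fin k → Fin k → (H →L[ℂ] H)), MatPos A → MatPos fun i j => φ (A i j)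

/-- `c` is a completely bounded bound for `φ` as a map on `M`. -/
def CBBoundOn (M : VonNeumannAlgebra H) (φ : (H →L[ℂ] H) →ₗ[ℂ] (H →L[ℂ] H))
    (c : ℝ) : Prop :=
  ∀ (k : ℕ) (A : Fin k → Fin k → (H →L[ℂ] H)), (∀ i j, A i j ∈ M) →
    matNormLe A 1 → matNormLe (fun i j => φ (A i j)) c

/-- The completely bounded norm of `φ` as a map on `M`. -/
def cbNormOn (M : VonNeumannAlgebra H) (φ : (H →L[ℂ] H) →ₗ[ℂ] (H →L[ℂ] H)) : ℝ :=
  sInf {c : ℝ | 0 ≤ c ∧ CBBoundOn M φ c}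

/-- `φ` is completely bounded as a map on `M`. -/
def IsCBOn (M : VonNeumannAlgebra H) (φ : (H →L[ℂ] H) →ₗ[ℂ] (H →L[ℂ] H)) : Prop :=
  ∃ c, 0 ≤ c ∧ CBBoundOn M φ c

/-- `φ` is normal as a map on `M`: every normal functional composed with `φ`
is again normal (i.e. implemented by a trace class operator). -/
def NormalOn {ι : Type*} (b : HilbertBasis ι ℂ H) (M : VonNeumannAlgebra H)
    (φ : (H →L[ℂ] H) →ₗ[ℂ] (H →L[ℂ] H)) : Prop :=
  ∀ T, IsTraceClass T → ∃ T', IsTraceClass T' ∧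
    ∀ A ∈ M, pairing b (φ A) T = pairing b A T'

/-- The map `Ad_V : X ↦ V* X V`. -/
def AdL (V : H →L[ℂ] H) : (H →L[ℂ] H) →ₗ[ℂ] (H →L[ℂ] H) where
  toFun X := star V * X * V
  map_add' X Y := by simp [add_mul, mul_add]
  map_smul' c X := by simp [smul_mul_assoc, mul_smul_comm]

/-- `p` is a minimal (nonzero) projection in `M`. -/
def IsMinimalProjection (M : VonNeumannAlgebra H) (p : H →L[ℂ] H) : Prop :=
  p ∈ M ∧ IsIdempotentElem p ∧ IsSelfAdjoint p ∧ p ≠ 0 ∧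
    ∀ q, q ∈ M → IsIdempotentElem q → IsSelfAdjoint q → q ≠ 0 →
      q * p = q → p * q = q → q = p

/-- A factor is of type I precisely when it contains a minimal projection. -/
def IsTypeI (M : VonNeumannAlgebra H) : Prop :=
  ∃ p, IsMinimalProjection M p




variable {K : Type*} [NormedAddCommGroup K] [InnerProductSpace ℂ K] [CompleteSpace K]

/-- `T` is a Hilbert–Schmidt operator (relative to a Hilbert basis `e`;
this does not depend on the choice of `e`). -/
def IsHS {ι : Type*} (e : HilbertBasis ι ℂ K) (T : K →L[ℂ] K) : Prop :=
  Summable fun i => ‖T (e i)‖ ^ 2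

/-- A model of the Hilbert space `HS(K)` of Hilbert–Schmidt operators on `K`,
with `B(K)` acting by left multiplications `Lmul` and right multiplications
`Rmul`.  `toOp` regards a vector of `H` as an operator on `K`; its range is
exactly the set of Hilbert–Schmidt operators, and the inner product of `H` is
`(x|y) = Tr (x y*)`, i.e. `⟪x, y⟫ = Σᵢ ⟪x eᵢ, y eᵢ⟫`. -/
structure HSModel {ι : Type*} (e : HilbertBasis ι ℂ K) (H : Type*)
    [NormedAddCommGroup H] [InnerProductSpace ℂ H] [CompleteSpace H] where
  toOp : H →ₗ[ℂ] (K →L[ℂ] K)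
  inj : Function.Injective toOp
  mem_range : ∀ T : K →L[ℂ] K, IsHS e T ↔ ∃ x : H, toOp x = T
  inner_eq : ∀ x y : H, ⟪x, y⟫ = ∑' i, ⟪toOp x (e i), toOp y (e i)⟫
  Lmul : (K →L[ℂ] K) → (H →L[ℂ] H)
  Lmul_eq : ∀ a x, toOp (Lmul a x) = a ∘L toOp x
  Rmul : (K →L[ℂ] K) → (H →L[ℂ] H)
  Rmul_eq : ∀ a x, toOp (Rmul a x) = toOp x ∘L a

/-- The operator `T` has rank at most `k`. -/
def rankLE (T : K →L[ℂ] K) (k : ℕ) : Prop :=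
  Module.rank ℂ (LinearMap.range (T : K →ₗ[ℂ] K)) ≤ (k : Cardinal)

variable {H : Type*} [NormedAddCommGroup H] [InnerProductSpace ℂ H] [CompleteSpace H]
  {ι : Type*} {e : HilbertBasis ι ℂ K}

/-- `Φ` restricts to the map `φ̃ : R_y L_x ↦ R_y L_{φ(x)}` on `alg(M', M)` for
`M = L_{B(K)}`. -/
def HSExt (m : HSModel e H) (φ : (K →L[ℂ] K) →ₗ[ℂ] (K →L[ℂ] K))
    (Φ : (H →L[ℂ] H) →ₗ[ℂ] (H →L[ℂ] H)) : Prop :=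
  ∀ a x : K →L[ℂ] K, Φ (m.Rmul a ∘L m.Lmul x) = m.Rmul a ∘L m.Lmul (φ x)

/-- `φ` is `k`-positive. -/
def kPos (k : ℕ) (φ : (K →L[ℂ] K) →ₗ[ℂ] (K →L[ℂ] K)) : Prop :=
  ∀ A : Fin k → Fin k → (K →L[ℂ] K), MatPos A → MatPos fun i j => φ (A i j)

/-- `φ` is completely bounded (as a map on all of `B(K)`). -/
def IsCBFullK (φ : (K →L[ℂ] K) →ₗ[ℂ] (K →L[ℂ] K)) : Prop :=
  ∃ c, 0 ≤ c ∧ ∀ (k : ℕ) (A : Fin k → Fin k → (K →L[ℂ] K)),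
    matNormLe A 1 → matNormLe (fun i j => φ (A i j)) c

/-- `φ` belongs to `CB^σ(B(K))`: it is normal and completely bounded. -/
def NormalCB (e : HilbertBasis ι ℂ K) (φ : (K →L[ℂ] K) →ₗ[ℂ] (K →L[ℂ] K)) : Prop :=
  (∃ φst, IsNormalPair e φ φst) ∧ IsCBFullK φ

/-- The cone `𝒮_k` of `T(H)`: the trace-norm closed convex cone generated by
the `ω_{x,x} = x ⊠ x` with `rank x ≤ k` (rank as an operator on `K`). -/
def SchmidtCone (m : HSModel e H) (k : ℕ) : Set (H →L[ℂ] H) :=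
  {T | ∀ ε : ℝ, 0 < ε → ∃ (n : ℕ) (x : Fin n → H),
    (∀ i, rankLE (m.toOp (x i)) k) ∧
      traceNorm (T - ∑ i, rankOne (x i) (x i)) < ε}

/-- `ψ` belongs to the convex cone `𝔼_k` generated by the maps `Ad_V` with
`rank V ≤ k`. -/
def InEk (k : ℕ) (ψ : (K →L[ℂ] K) →ₗ[ℂ] (K →L[ℂ] K)) : Prop :=
  ∃ (n : ℕ) (V : Fin n → (K →L[ℂ] K)), (∀ i, rankLE (V i) k) ∧
    ∀ x, ψ x = ∑ i, star (V i) * x * V i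

/-- `φ` (with Choi trace-class operator `Dphi = D_φ`) is `k`-superpositive:
it lies in the `‖·‖_D`-closure of the cone `𝔼_k`, where `‖ψ‖_D = ‖D_ψ‖_{T(H)}`. -/
def kSuper {ιH : Type*} (bH : HilbertBasis ιH ℂ H) (m : HSModel e H) (x0 : H)
    (k : ℕ) (Dphi : H →L[ℂ] H) : Prop :=
  ∀ ε : ℝ, 0 < ε → ∃ ψ Ψ Ψst, InEk k ψ ∧ HSExt m ψ Ψ ∧ IsNormalPair bH Ψ Ψst ∧
    traceNorm (Dphi - Ψst (rankOne x0 x0)) < ε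

section NuclearRepresentations

variable {ι' : Type*}

lemma rankOne_apply (x y z : H) : rankOne x y z = ⟪y, z⟫ • x := by
  simp [rankOne]

/-- `x`, `y` give a nuclear representation of `T` of total weight `c`. -/
def IsNuclearRep (T : H →L[ℂ] H) (x y : ℕ → H) (c : ℝ) : Prop :=
  HasSum (fun n => ‖x n‖ * ‖y n‖) c ∧ ∀ z, T z = ∑' n, ⟪y n, z⟫ • x n

/-- `T` has a nuclear representation of total weight `c`. -/
def HasNuclearWeight (T : H →L[ℂ] H) (c : ℝ) : Prop :=
  ∃ x y : ℕ → H, IsNuclearRep T x y c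

lemma isTraceClass_iff_exists_hasNuclearWeight {T : H →L[ℂ] H} :
    IsTraceClass T ↔ ∃ c, HasNuclearWeight T c :=
  ⟨fun ⟨x, y, hs, hT⟩ => ⟨_, x, y, hs.hasSum, hT⟩,
    fun ⟨_, x, y, hs, hT⟩ => ⟨x, y, hs.summable, hT⟩⟩

lemma HasNuclearWeight.nonneg {T : H →L[ℂ] H} {c : ℝ} (h : HasNuclearWeight T c) : 0 ≤ c := by
  obtain ⟨x, y, hs, -⟩ := h
  exact hs.nonneg fun n => by positivity

lemma HasNuclearWeight.traceNorm_le {T : H →L[ℂ] H} {c : ℝ} (h : HasNuclearWeight T c) :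
    traceNorm T ≤ c :=
  csInf_le ⟨0, fun _ hd => HasNuclearWeight.nonneg hd⟩ h

lemma IsTraceClass.exists_hasNuclearWeight_lt {T : H →L[ℂ] H} (hT : IsTraceClass T) {ε : ℝ}
    (h : traceNorm T < ε) : ∃ c < ε, HasNuclearWeight T c := by
  obtain ⟨c, hc, hlt⟩ := exists_lt_of_csInf_lt (isTraceClass_iff_exists_hasNuclearWeight.1 hT) h
  exact ⟨c, hlt, hc⟩

lemma IsNuclearRep.hasSum {T : H →L[ℂ] H} {x y : ℕ → H} {c : ℝ} (h : IsNuclearRep T x y c)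
    (z : H) : HasSum (fun n => ⟪y n, z⟫ • x n) (T z) := by
  rw [h.2 z]
  refine Summable.hasSum (Summable.of_norm_bounded (h.1.summable.mul_left ‖z‖) fun n => ?_)
  rw [norm_smul]
  calc ‖⟪y n, z⟫‖ * ‖x n‖ ≤ ‖y n‖ * ‖z‖ * ‖x n‖ := by gcongr; exact norm_inner_le_norm _ _
    _ = ‖z‖ * (‖x n‖ * ‖y n‖) := by ring

lemma hasNuclearWeight_rankOne (x y : H) : HasNuclearWeight (rankOne x y) (‖x‖ * ‖y‖) := by
  refine ⟨fun n => if n = 0 then x else 0, fun n => if n = 0 then y else 0, ?_, fun z => ?_⟩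
  · simpa using hasSum_single (f := fun n : ℕ =>
      ‖(if n = 0 then x else 0)‖ * ‖(if n = 0 then y else 0)‖) 0 (fun n hn => by simp [hn])
  · rw [tsum_eq_single 0 fun n hn => by simp [hn], rankOne_apply]
    simp

lemma HasNuclearWeight.add {S T : H →L[ℂ] H} {c d : ℝ} (hS : HasNuclearWeight S c)
    (hT : HasNuclearWeight T d) : HasNuclearWeight (S + T) (c + d) := by
  obtain ⟨x, y, h⟩ := hS
  obtain ⟨x', y', h'⟩ := hT
  let σ : ℕ ≃ ℕ ⊕ ℕ := Equiv.natSumNatEquivNat.symm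
  refine ⟨fun n => Sum.elim x x' (σ n), fun n => Sum.elim y y' (σ n), ?_, fun z => ?_⟩
  · exact (σ.hasSum_iff (f := fun s => ‖Sum.elim x x' s‖ * ‖Sum.elim y y' s‖)).2
      (HasSum.sum h.1 h'.1)
  · exact ((σ.hasSum_iff (f := fun s => ⟪Sum.elim y y' s, z⟫ • Sum.elim x x' s)).2
      (HasSum.sum (h.hasSum z) (h'.hasSum z))).tsum_eq.symm

lemma hasNuclearWeight_zero : HasNuclearWeight (0 : H →L[ℂ] H) 0 :=
  ⟨0, 0, by simp, by simp⟩

lemma HasNuclearWeight.sum {α : Type*} (s : Finset α) {T : α → H →L[ℂ] H} {c : α → ℝ}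
    (h : ∀ i ∈ s, HasNuclearWeight (T i) (c i)) :
    HasNuclearWeight (∑ i ∈ s, T i) (∑ i ∈ s, c i) := by
  classical
  induction s using Finset.induction_on with
  | empty => simpa using hasNuclearWeight_zero
  | insert a s ha ih =>
    rw [Finset.sum_insert ha, Finset.sum_insert ha]
    exact (h a (Finset.mem_insert_self a s)).add
      (ih fun i hi => h i (Finset.mem_insert_of_mem hi))

lemma HasNuclearWeight.neg {T : H →L[ℂ] H} {c : ℝ} (h : HasNuclearWeight T c) :
    HasNuclearWeight (-T) c := by
  obtain ⟨x, y, hs, hT⟩ := h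
  refine ⟨fun n => -x n, y, by simpa using hs, fun z => ?_⟩
  simp [hT z, tsum_neg]

lemma HasNuclearWeight.sub {S T : H →L[ℂ] H} {c d : ℝ} (hS : HasNuclearWeight S c)
    (hT : HasNuclearWeight T d) : HasNuclearWeight (S - T) (c + d) := by
  rw [sub_eq_add_neg]
  exact hS.add hT.neg

lemma IsTraceClass.sub {S T : H →L[ℂ] H} (hS : IsTraceClass S) (hT : IsTraceClass T) :
    IsTraceClass (S - T) := by
  obtain ⟨c, hc⟩ := isTraceClass_iff_exists_hasNuclearWeight.1 hS
  obtain ⟨d, hd⟩ := isTraceClass_iff_exists_hasNuclearWeight.1 hT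
  exact isTraceClass_iff_exists_hasNuclearWeight.2 ⟨_, hc.sub hd⟩

lemma isTraceClass_rankOne (x y : H) : IsTraceClass (rankOne x y) :=
  isTraceClass_iff_exists_hasNuclearWeight.2 ⟨_, hasNuclearWeight_rankOne x y⟩

lemma IsTraceClass.sum {α : Type*} (s : Finset α) {T : α → H →L[ℂ] H}
    (h : ∀ i, IsTraceClass (T i)) : IsTraceClass (∑ i ∈ s, T i) := by
  choose c hc using fun i => isTraceClass_iff_exists_hasNuclearWeight.1 (h i)
  exact isTraceClass_iff_exists_hasNuclearWeight.2 ⟨_, HasNuclearWeight.sum s fun i _ => hc i⟩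

/-- A bounded operator applied on the left, and its adjoint on the right, transforms the vectors
of a nuclear representation. -/
lemma IsNuclearRep.conj {T : H →L[ℂ] H} {x y : ℕ → H} {c : ℝ} (h : IsNuclearRep T x y c)
    (W : H →L[ℂ] H) :
    ∃ d, IsNuclearRep (W * T * star W) (fun n => W (x n)) (fun n => W (y n)) d := by
  have hs : Summable fun n => ‖W (x n)‖ * ‖W (y n)‖ := by
    refine Summable.of_nonneg_of_le (fun n => by positivity) (fun n => ?_)
      (h.1.summable.mul_left (‖W‖ * ‖W‖))
    calc ‖W (x n)‖ * ‖W (y n)‖ ≤ (‖W‖ * ‖x n‖) * (‖W‖ * ‖y n‖) := by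
          gcongr <;> exact W.le_opNorm _
      _ = ‖W‖ * ‖W‖ * (‖x n‖ * ‖y n‖) := by ring
  refine ⟨_, hs.hasSum, fun z => ?_⟩
  have key := (h.hasSum (star W z)).mapL W
  simp only [map_smul, star_eq_adjoint, adjoint_inner_right] at key
  simpa [star_eq_adjoint] using key.tsum_eq.symm

/-- The series defining the trace pairing converges, and it may be computed from a nuclear
representation. -/
lemma IsNuclearRep.summable_and_hasSum_pairing (b : HilbertBasis ι' ℂ H) (A : H →L[ℂ] H)
    {T : H →L[ℂ] H} {x y : ℕ → H} {c : ℝ} (h : IsNuclearRep T x y c) :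
    (Summable fun i => ⟪b i, A (T (b i))⟫) ∧
      HasSum (fun n => ⟪y n, A (x n)⟫) (pairing b A T) := by
  let F : ℕ × ι' → ℂ := fun p => ⟪y p.1, b p.2⟫ * ⟪b p.2, A (x p.1)⟫
  have hrow : ∀ n, HasSum (fun i => F (n, i)) ⟪y n, A (x n)⟫ := fun n =>
    b.hasSum_inner_mul_inner _ _
  have hbound : ∀ n (s : Finset ι'), ∑ i ∈ s, ‖F (n, i)‖ ≤ ‖A‖ * (‖x n‖ * ‖y n‖) := by
    intro n s
    have hb (v : H) : Real.sqrt (∑ i ∈ s, ‖⟪b i, v⟫‖ ^ 2) ≤ ‖v‖ := by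
      rw [Real.sqrt_le_left (norm_nonneg _)]
      exact b.orthonormal.sum_inner_products_le v
    calc ∑ i ∈ s, ‖F (n, i)‖ = ∑ i ∈ s, ‖⟪b i, y n⟫‖ * ‖⟪b i, A (x n)⟫‖ := by
          simp only [F, norm_mul]
          exact Finset.sum_congr rfl fun i _ => by rw [norm_inner_symm]
      _ ≤ Real.sqrt (∑ i ∈ s, ‖⟪b i, y n⟫‖ ^ 2) * Real.sqrt (∑ i ∈ s, ‖⟪b i, A (x n)⟫‖ ^ 2) :=
          Real.sum_mul_le_sqrt_mul_sqrt _ _ _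
      _ ≤ ‖y n‖ * (‖A‖ * ‖x n‖) :=
          mul_le_mul (hb _) ((hb _).trans (A.le_opNorm _)) (Real.sqrt_nonneg _) (norm_nonneg _)
      _ = _ := by ring
  have hrs : ∀ n, Summable fun i => ‖F (n, i)‖ := fun n =>
    summable_of_sum_le (fun _ => norm_nonneg _) (hbound n)
  have hF : Summable F := by
    refine Summable.of_norm ((summable_prod_of_nonneg fun _ => norm_nonneg _).2 ⟨hrs, ?_⟩)
    refine Summable.of_nonneg_of_le (fun n => tsum_nonneg fun _ => norm_nonneg _) (fun n => ?_)
      (h.1.summable.mul_left ‖A‖)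
    exact (hrs n).tsum_le_of_sum_le (hbound n)
  have hcol : ∀ i, HasSum (fun n => F (n, i)) ⟪b i, A (T (b i))⟫ := fun i => by
    have := ((h.hasSum (b i)).mapL A).mapL (innerSL ℂ (b i))
    simpa [F, inner_smul_right] using this
  have hdiag : HasSum (fun i => ⟪b i, A (T (b i))⟫) (∑' p, F p) :=
    ((Equiv.prodComm ι' ℕ).hasSum_iff.2 hF.hasSum).prod_fiberwise hcol
  refine ⟨hdiag.summable, ?_⟩
  have hpair : pairing b A T = ∑' p, F p := hdiag.tsum_eq
  rw [hpair]
  exact hF.hasSum.prod_fiberwise hrow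

lemma pairing_rankOne_right (b : HilbertBasis ι' ℂ H) (A : H →L[ℂ] H) (x y : H) :
    pairing b A (rankOne x y) = ⟪y, A x⟫ := by
  rw [← b.tsum_inner_mul_inner y (A x)]
  simp [pairing, tr, rankOne_apply]

lemma pairing_rankOne_left (b : HilbertBasis ι' ℂ H) (T : H →L[ℂ] H) (x y : H) :
    pairing b (rankOne x y) T = ⟪y, T x⟫ := by
  rw [← adjoint_inner_left, ← b.tsum_inner_mul_inner _ x]
  simp [pairing, tr, rankOne_apply, adjoint_inner_left]

lemma conj_rankOne (W : H →L[ℂ] H) (x y : H) :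
    W * rankOne x y * star W = rankOne (W x) (W y) := by
  ext z
  simp [rankOne_apply, star_eq_adjoint, adjoint_inner_right]

/-- The map `A ↦ ∑ i, Wᵢ* A Wᵢ` is normal, with predual map `T ↦ ∑ i, Wᵢ T Wᵢ*`. -/
lemma isNormalPair_sum_AdL (b : HilbertBasis ι' ℂ H) {n : ℕ} (W : Fin n → H →L[ℂ] H) :
    IsNormalPair b (∑ i, AdL (W i)) (∑ i, AdL (star (W i))) := by
  have hst (T : H →L[ℂ] H) :
      (∑ i, AdL (star (W i))) T = ∑ i, W i * T * star (W i) := by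
    simp [LinearMap.sum_apply, AdL]
  refine ⟨fun T hT => ?_, fun A T hT => ?_⟩ <;>
    obtain ⟨c, x, y, h⟩ := isTraceClass_iff_exists_hasNuclearWeight.1 hT
  · rw [hst]
    refine IsTraceClass.sum _ fun i => ?_
    obtain ⟨d, hd⟩ := h.conj (W i)
    exact isTraceClass_iff_exists_hasNuclearWeight.2 ⟨d, _, _, hd⟩
  · have hL : HasSum (fun m => ∑ i, ⟪W i (y m), A (W i (x m))⟫)
        (pairing b ((∑ i, AdL (W i)) A) T) := by
      refine (h.summable_and_hasSum_pairing b _).2.congr_fun ?_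
      intro m
      simp [LinearMap.sum_apply, AdL, star_eq_adjoint, adjoint_inner_right]
    have hR (i : Fin n) : HasSum (fun m => ⟪W i (y m), A (W i (x m))⟫)
        (pairing b A (W i * T * star (W i))) := by
      obtain ⟨d, hd⟩ := h.conj (W i)
      exact (hd.summable_and_hasSum_pairing b A).2
    have hsum : ∑ i, pairing b A (W i * T * star (W i)) =
        pairing b A (∑ i, W i * T * star (W i)) := by
      have hs (i : Fin n) : Summable fun j => ⟪b j, A ((W i * T * star (W i)) (b j))⟫ := by
        obtain ⟨d, hd⟩ := h.conj (W i)
        exact (hd.summable_and_hasSum_pairing b A).1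
      simp only [pairing, tr, ContinuousLinearMap.comp_apply]
      rw [← Summable.tsum_finsetSum fun i _ => hs i]
      simp
    rw [hst, ← hsum]
    exact hL.unique (hasSum_sum fun i _ => hR i)

lemma hasNuclearWeight_rankOne_sub_rankOne (x y : H) :
    HasNuclearWeight (rankOne x x - rankOne y y) (‖x - y‖ * ‖x‖ + ‖y‖ * ‖x - y‖) := by
  have : rankOne x x - rankOne y y = rankOne (x - y) x + rankOne y (x - y) := by
    ext z
    simp only [sub_apply, add_apply, rankOne_apply,
      inner_sub_left, smul_sub, sub_smul]
    abel
  rw [this]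
  exact (hasNuclearWeight_rankOne _ _).add (hasNuclearWeight_rankOne _ _)

end NuclearRepresentations

namespace HSModel

variable (m : HSModel e H)

lemma Lmul_Rmul_comm (a x : K →L[ℂ] K) (z : H) :
    m.Lmul x (m.Rmul a z) = m.Rmul a (m.Lmul x z) :=
  m.inj (by simp only [m.Lmul_eq, m.Rmul_eq, ContinuousLinearMap.comp_assoc])

lemma Lmul_mul (a x : K →L[ℂ] K) (z : H) : m.Lmul (a * x) z = m.Lmul a (m.Lmul x z) :=
  m.inj (by simp only [m.Lmul_eq, ContinuousLinearMap.mul_def, ContinuousLinearMap.comp_assoc])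

lemma Lmul_sum {α : Type*} (s : Finset α) (a : α → K →L[ℂ] K) (z : H) :
    m.Lmul (∑ i ∈ s, a i) z = ∑ i ∈ s, m.Lmul (a i) z :=
  m.inj (by ext w; simp [m.Lmul_eq])

lemma inner_Lmul_star_right (a : K →L[ℂ] K) (x y : H) :
    ⟪x, m.Lmul (star a) y⟫ = ⟪m.Lmul a x, y⟫ := by
  simp [m.inner_eq, m.Lmul_eq, star_eq_adjoint, adjoint_inner_right]

lemma Lmul_star (a : K →L[ℂ] K) : m.Lmul (star a) = star (m.Lmul a) := by
  ext y
  refine ext_inner_left ℂ fun x => ?_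
  rw [inner_Lmul_star_right, star_eq_adjoint, adjoint_inner_right]

lemma isHS_rankOne (v : K) (j : ι) : IsHS e (rankOne v (e j)) := by
  classical
  refine summable_of_ne_finset_zero (s := {j}) fun i hi => ?_
  rw [Finset.mem_singleton] at hi
  simp [rankOne_apply, e.orthonormal.2 (Ne.symm hi)]

/-- The vector of `H` which is the operator `v ⊠ eⱼ` on `K`. -/
def ofRankOne (v : K) (j : ι) : H :=
  ((m.mem_range _).1 (isHS_rankOne (e := e) v j)).choose

lemma toOp_ofRankOne (v : K) (j : ι) : m.toOp (m.ofRankOne v j) = rankOne v (e j) :=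
  ((m.mem_range _).1 (isHS_rankOne (e := e) v j)).choose_spec

lemma inner_ofRankOne (v : K) (j : ι) (z : H) :
    ⟪m.ofRankOne v j, z⟫ = ⟪v, m.toOp z (e j)⟫ := by
  rw [m.inner_eq, tsum_eq_single j]
  · simp [toOp_ofRankOne, rankOne_apply, e.orthonormal.1 j]
  · intro i hi
    simp [toOp_ofRankOne, rankOne_apply, e.orthonormal.2 hi.symm]

lemma eq_of_inner_ofRankOne {z w : H}
    (h : ∀ v j, ⟪m.ofRankOne v j, z⟫ = ⟪m.ofRankOne v j, w⟫) : z = w := by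
  refine m.inj (ContinuousLinearMap.ext_on (s := Set.range e) ?_ ?_)
  · rw [Submodule.dense_iff_topologicalClosure_eq_top]
    exact e.dense_span
  · rintro _ ⟨j, rfl⟩
    refine ext_inner_left ℂ fun v => ?_
    rw [← inner_ofRankOne, ← inner_ofRankOne, h]

lemma eq_of_inner_ofRankOne_apply {S T : H →L[ℂ] H}
    (h : ∀ u j v l, ⟪m.ofRankOne v l, S (m.ofRankOne u j)⟫ =
      ⟪m.ofRankOne v l, T (m.ofRankOne u j)⟫) : S = T := by
  refine ContinuousLinearMap.adjoint.injective (ContinuousLinearMap.ext fun w => ?_)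
  refine m.eq_of_inner_ofRankOne fun u j => ?_
  have hST : S (m.ofRankOne u j) = T (m.ofRankOne u j) :=
    m.eq_of_inner_ofRankOne fun v l => h u j v l
  rw [adjoint_inner_right, adjoint_inner_right, hST]

lemma Rmul_comp_Lmul_rankOne (u v : K) (j l : ι) :
    m.Rmul (rankOne (e l) (e j)) ∘L m.Lmul (rankOne u v) =
      rankOne (m.ofRankOne u j) (m.ofRankOne v l) := by
  ext z
  refine m.inj (ContinuousLinearMap.ext fun w => ?_)
  simp [m.Rmul_eq, m.Lmul_eq, rankOne_apply, inner_ofRankOne, toOp_ofRankOne, smul_smul,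
    mul_comm]

lemma Rmul_comp_Lmul_sum_conj {n : ℕ} (V : Fin n → K →L[ℂ] K) (a x : K →L[ℂ] K) :
    m.Rmul a ∘L m.Lmul (∑ i, star (V i) * x * V i) =
      ∑ i, star (m.Lmul (V i)) * (m.Rmul a ∘L m.Lmul x) * m.Lmul (V i) := by
  ext z
  simp [Lmul_sum, Lmul_mul, map_sum, ← Lmul_star, Lmul_Rmul_comm]

/-- A normal extension of `∑ i, Ad_{Vᵢ}` sends `x0 ⊠ x0` to `∑ i, Vᵢ x0 ⊠ Vᵢ x0` under its
predual map. -/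
lemma predual_rankOne_eq_sum {ιH : Type*} {bH : HilbertBasis ιH ℂ H} (x0 : H) {n : ℕ}
    (V : Fin n → K →L[ℂ] K) {ψ : (K →L[ℂ] K) →ₗ[ℂ] (K →L[ℂ] K)}
    (hψ : ∀ x, ψ x = ∑ i, star (V i) * x * V i) {Ψ Ψst : (H →L[ℂ] H) →ₗ[ℂ] (H →L[ℂ] H)}
    (hext : HSExt m ψ Ψ) (hnp : IsNormalPair bH Ψ Ψst) :
    Ψst (rankOne x0 x0) = ∑ i, rankOne (m.Lmul (V i) x0) (m.Lmul (V i) x0) := by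
  refine m.eq_of_inner_ofRankOne_apply fun u j v l => ?_
  rw [← pairing_rankOne_left bH, ← hnp.2 _ _ (isTraceClass_rankOne x0 x0),
    pairing_rankOne_right, ← Rmul_comp_Lmul_rankOne, hext, hψ, Rmul_comp_Lmul_sum_conj,
    Rmul_comp_Lmul_rankOne]
  simp [star_eq_adjoint, adjoint_inner_right, rankOne_apply, mul_comm]

lemma norm_Lmul_le_of_isSelfAdjoint_of_isIdempotentElem {p : K →L[ℂ] K} (hp : IsSelfAdjoint p)
    (hp' : IsIdempotentElem p) (z : H) : ‖m.Lmul p z‖ ≤ ‖z‖ := by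
  have h : ⟪m.Lmul p z, m.Lmul p z⟫ = ⟪z, m.Lmul p z⟫ := by
    rw [← inner_Lmul_star_right, hp.star_eq, ← Lmul_mul, hp'.eq]
  have h2 : ‖m.Lmul p z‖ * ‖m.Lmul p z‖ ≤ ‖z‖ * ‖m.Lmul p z‖ := by
    calc ‖m.Lmul p z‖ * ‖m.Lmul p z‖ = ‖⟪m.Lmul p z, m.Lmul p z⟫‖ := by
          simp [inner_self_eq_norm_sq_to_K, sq]
      _ ≤ _ := h ▸ norm_inner_le_norm _ _
  rcases (norm_nonneg (m.Lmul p z)).eq_or_lt with h0 | h0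
  · rw [← h0]; exact norm_nonneg _
  · exact le_of_mul_le_mul_right h2 h0

lemma rankLE_toOp_Lmul {V : K →L[ℂ] K} {k : ℕ} (hV : rankLE V k) (z : H) :
    rankLE (m.toOp (m.Lmul V z)) k := by
  rw [m.Lmul_eq]
  refine le_trans (Submodule.rank_mono ?_) hV
  rintro _ ⟨w, rfl⟩
  exact ⟨m.toOp z w, rfl⟩

/-- If `x0` is cyclic, vectors of rank at most `k` are approximated by `V x0` with
`rank V ≤ k`. -/
lemma exists_rankLE_norm_sub_lt {x0 : H}
    (hcyc : Dense {y : H | ∃ a : K →L[ℂ] K, m.Lmul a x0 = y}) {k : ℕ} {x : H}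
    (hx : rankLE (m.toOp x) k) {δ : ℝ} (hδ : 0 < δ) :
    ∃ V : K →L[ℂ] K, rankLE V k ∧ ‖x - m.Lmul V x0‖ < δ := by
  obtain ⟨_, ⟨a, rfl⟩, ha⟩ := hcyc.exists_dist_lt x hδ
  let R : Submodule ℂ K := LinearMap.range (m.toOp x : K →ₗ[ℂ] K)
  have hR : Module.Finite ℂ R :=
    Module.rank_lt_aleph0_iff.1 (lt_of_le_of_lt hx (Cardinal.natCast_lt_aleph0))
  let p : K →L[ℂ] K := R.starProjection
  refine ⟨p * a, le_trans (Submodule.rank_mono ?_) hx, ?_⟩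
  · rintro _ ⟨w, rfl⟩
    exact R.starProjection_apply_mem (a w)
  · have hpx : m.Lmul p x = x := by
      refine m.inj (ContinuousLinearMap.ext fun w => ?_)
      rw [m.Lmul_eq]
      exact Submodule.starProjection_eq_self_iff.2 ⟨w, rfl⟩
    have : x - m.Lmul (p * a) x0 = m.Lmul p (x - m.Lmul a x0) := by
      rw [map_sub, hpx, Lmul_mul]
    rw [this]
    refine lt_of_le_of_lt (m.norm_Lmul_le_of_isSelfAdjoint_of_isIdempotentElem
      (isSelfAdjoint_starProjection R) R.isIdempotentElem_starProjection _) ?_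
    rwa [← dist_eq_norm]

end HSModel

/-- Small perturbations of `x` change `x ⊠ x` by little in trace norm. -/
lemma exists_pos_hasNuclearWeight_lt (x : H) {ε : ℝ} (hε : 0 < ε) :
    ∃ δ > 0, ∀ y, ‖x - y‖ < δ → ∃ c < ε, HasNuclearWeight (rankOne x x - rankOne y y) c := by
  have hlim : Filter.Tendsto (fun y => ‖x - y‖ * ‖x‖ + ‖y‖ * ‖x - y‖) (nhds x) (nhds 0) := by
    have : Continuous fun y => ‖x - y‖ * ‖x‖ + ‖y‖ * ‖x - y‖ := by fun_prop
    simpa using this.tendsto x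
  obtain ⟨δ, hδ, h⟩ := Metric.eventually_nhds_iff.1 (hlim.eventually_lt_const hε)
  refine ⟨δ, hδ, fun y hy => ⟨_, h ?_, hasNuclearWeight_rankOne_sub_rankOne x y⟩⟩
  rwa [dist_comm, dist_eq_norm]

/-- Proposition 6.1.  A normal completely positive map
`φ : B(K) → B(K)` is `k`-superpositive — i.e. lies in the closure of the cone
`𝔼_k` generated by `{Ad_V : rank V ≤ k}` with respect to the norm
`‖φ‖_D = ‖D_φ‖_{T(H)}` — if and only if `D_φ ∈ 𝒮_k`. -/
theorem statement15
    {K : Type*} [NormedAddCommGroup K] [InnerProductSpace ℂ K] [CompleteSpace K]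
    [TopologicalSpace.SeparableSpace K]
    {ι : Type*} (e : HilbertBasis ι ℂ K)
    {H : Type*} [NormedAddCommGroup H] [InnerProductSpace ℂ H] [CompleteSpace H]
    {ιH : Type*} (bH : HilbertBasis ιH ℂ H)
    (m : HSModel e H) (x0 : H) (hx0 : ‖x0‖ = 1)
    (hcyc : Dense {y : H | ∃ a : K →L[ℂ] K, m.Lmul a x0 = y})
    (hsep : ∀ a : K →L[ℂ] K, m.Lmul a x0 = 0 → m.Lmul a = 0)
    (k : ℕ)
    (φ : (K →L[ℂ] K) →ₗ[ℂ] (K →L[ℂ] K))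
    (hnormal : ∃ φst, IsNormalPair e φ φst) (hcp : ∀ n : ℕ, kPos n φ)
    (Φ Φst : (H →L[ℂ] H) →ₗ[ℂ] (H →L[ℂ] H))
    (hext : HSExt m φ Φ) (hnp : IsNormalPair bH Φ Φst) :
    kSuper bH m x0 k (Φst (rankOne x0 x0)) ↔ Φst (rankOne x0 x0) ∈ SchmidtCone m k := by
  have hD : IsTraceClass (Φst (rankOne x0 x0)) := hnp.1 _ (isTraceClass_rankOne x0 x0)
  refine ⟨fun h ε hε => ?_, fun h ε hε => ?_⟩
  · obtain ⟨ψ, Ψ, Ψst, ⟨n, V, hV, hψ⟩, hΨ, hnpΨ, hlt⟩ := h ε hε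
    refine ⟨n, fun i => m.Lmul (V i) x0, fun i => m.rankLE_toOp_Lmul (hV i) x0, ?_⟩
    rwa [← m.predual_rankOne_eq_sum x0 V hψ hΨ hnpΨ]
  · obtain ⟨n, x, hx, hlt⟩ := h (ε / 2) (half_pos hε)
    obtain ⟨c, hc, hcw⟩ := IsTraceClass.exists_hasNuclearWeight_lt
      (hD.sub (IsTraceClass.sum _ fun i => isTraceClass_rankOne (x i) (x i))) hlt
    have hη : 0 < ε / 2 / (n + 1) := by positivity
    choose δ hδ hxδ using fun i => exists_pos_hasNuclearWeight_lt (x i) hη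
    choose V hV hVx using fun i => m.exists_rankLE_norm_sub_lt hcyc (hx i) (hδ i)
    choose d hd hdw using fun i => hxδ i _ (hVx i)
    refine ⟨∑ i, AdL (V i), ∑ i, AdL (m.Lmul (V i)), ∑ i, AdL (star (m.Lmul (V i))),
      ⟨n, V, hV, fun x => by simp [LinearMap.sum_apply, AdL]⟩, fun a x => ?_,
      isNormalPair_sum_AdL bH _, ?_⟩
    · simpa [LinearMap.sum_apply, AdL] using (m.Rmul_comp_Lmul_sum_conj V a x).symm
    · have hst : (∑ i, AdL (star (m.Lmul (V i)))) (rankOne x0 x0) =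
          ∑ i, rankOne (m.Lmul (V i) x0) (m.Lmul (V i) x0) := by
        simp only [LinearMap.sum_apply, ← conj_rankOne]
        simp [AdL]
      have hw := hcw.add (HasNuclearWeight.sum Finset.univ fun i _ => hdw i)
      rw [Finset.sum_sub_distrib, sub_add_sub_cancel] at hw
      rw [hst]
      refine lt_of_le_of_lt hw.traceNorm_le ?_
      have hsum : ∑ i, d i ≤ ε / 2 :=
        calc ∑ i, d i ≤ ∑ _i : Fin n, ε / 2 / (n + 1) := Finset.sum_le_sum fun i _ => (hd i).le
          _ = ε / 2 * (n / (n + 1)) := by simp; ring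
          _ ≤ ε / 2 * 1 := by
            gcongr
            exact div_le_one_of_le₀ (by linarith) (by positivity)
          _ = ε / 2 := mul_one _
      linarith

end ChoiInf
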